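/- (Robustness of the pessimistic proxies.) Suppose P_0 is a transition kernel with (P_0)_s^a ∈ (𝒫_k)_s^a for every k ∈ {1,…,K} and every (s,a), and let 𝒫̃_s^a := ∩_{k=1}^K (𝒫_k)_s^a (nonempty compact, containing (P_0)_s^a). Then for every policy π and every state s: V_{P_0}^π(s) ≥ V_𝒫̃^π(s) ≥ V_MP^π(s) ≥ V_AO^π(s). -/

import Mathlib

noncomputable section

/-- The probability simplex on a finite set `S`. -/
def simplex (S : Type*) [Fintype S] : Set (S → ℝ) :=
  {p | (∀ s, 0 ≤ p s) ∧ ∑ s, p s = 1}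

/-- Support function of a set of distributions: `σ_C(v) = inf_{p ∈ C} ∑_s p s * v s`. -/
def suppFn {S : Type*} [Fintype S] (C : Set (S → ℝ)) (v : S → ℝ) : ℝ :=
  sInf ((fun p => ∑ s, p s * v s) '' C)

/-- Robust Bellman operator of a policy `π`:
`(T_𝒫^π Q)(s,a) = r(s,a) + γ σ_{𝒫_s^a}(V_Q^π)` with `V_Q^π(s) = ∑_a π(a|s) Q(s,a)`. -/
def robustOp {S A : Type*} [Fintype S] [Fintype A] (r : S × A → ℝ) (γ : ℝ)
    (P : S → A → Set (S → ℝ)) (π : S → A → ℝ) (Q : S × A → ℝ) : S × A → ℝ :=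
  fun sa => r sa + γ * suppFn (P sa.1 sa.2) (fun s' => ∑ a', π s' a' * Q (s', a'))

/-- Optimal robust Bellman operator:
`(T_𝒫 Q)(s,a) = r(s,a) + γ σ_{𝒫_s^a}(s' ↦ max_{a'} Q(s',a'))`. -/
def optRobustOp {S A : Type*} [Fintype S] [Fintype A] [Nonempty A] (r : S × A → ℝ) (γ : ℝ)
    (P : S → A → Set (S → ℝ)) (Q : S × A → ℝ) : S × A → ℝ :=
  fun sa => r sa + γ * suppFn (P sa.1 sa.2)
    (fun s' => Finset.univ.sup' Finset.univ_nonempty (fun a' => Q (s', a')))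

/-- Averaging against a distribution preserves a uniform bound `v ≤ v' + c`. -/
theorem sum_mul_le_of_mem_simplex {S : Type*} [Fintype S] {p : S → ℝ} (hp : p ∈ simplex S)
    {v v' : S → ℝ} {c : ℝ} (h : ∀ s, v s ≤ v' s + c) :
    ∑ s, p s * v s ≤ ∑ s, p s * v' s + c :=
  calc ∑ s, p s * v s ≤ ∑ s, (p s * v' s + p s * c) :=
        Finset.sum_le_sum fun s _ => by
          rw [← mul_add]
          exact mul_le_mul_of_nonneg_left (h s) (hp.1 s)
    _ = ∑ s, p s * v' s + c := by
        rw [Finset.sum_add_distrib, ← Finset.sum_mul, hp.2, one_mul]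

theorem bddBelow_image_of_subset_simplex {S : Type*} [Fintype S] {C : Set (S → ℝ)}
    (hC : C ⊆ simplex S) (v : S → ℝ) :
    BddBelow ((fun p : S → ℝ => ∑ s, p s * v s) '' C) := by
  refine ⟨-∑ s, |v s|, ?_⟩
  rintro _ ⟨p, hp, rfl⟩
  have h := sum_mul_le_of_mem_simplex (hC hp) (v := 0) (v' := v) (c := ∑ s, |v s|) fun s => by
    have h1 := Finset.single_le_sum (f := fun s => |v s|) (fun i _ => abs_nonneg (v i))
      (Finset.mem_univ s)
    have h2 := neg_abs_le (v s)
    simp only [Pi.zero_apply]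
    linarith
  simp only [Pi.zero_apply, mul_zero, Finset.sum_const_zero] at h
  linarith

/-- The support function decreases in the set, increases in the vector, and commutes with
adding constants. -/
theorem suppFn_le_suppFn_add {S : Type*} [Fintype S] {C D : Set (S → ℝ)} (hne : C.Nonempty)
    (hCD : C ⊆ D) (hD : D ⊆ simplex S) {v v' : S → ℝ} {c : ℝ} (h : ∀ s, v s ≤ v' s + c) :
    suppFn D v ≤ suppFn C v' + c := by
  rw [← sub_le_iff_le_add]
  refine le_csInf (hne.image _) ?_
  rintro _ ⟨p, hp, rfl⟩
  rw [sub_le_iff_le_add]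
  exact (csInf_le (bddBelow_image_of_subset_simplex hD v) ⟨p, hCD hp, rfl⟩).trans
    (sum_mul_le_of_mem_simplex (hD (hCD hp)) h)

theorem robustOp_le_robustOp_add {S A : Type*} [Fintype S] [Fintype A] (r : S × A → ℝ) {γ : ℝ}
    (hγ0 : 0 ≤ γ) {C D : S → A → Set (S → ℝ)} (hne : ∀ s a, (C s a).Nonempty)
    (hCD : ∀ s a, C s a ⊆ D s a) (hD : ∀ s a, D s a ⊆ simplex S)
    {π : S → A → ℝ} (hπ : ∀ s, π s ∈ simplex A) {Q Q' : S × A → ℝ} {c : ℝ}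
    (h : ∀ sa, Q sa ≤ Q' sa + c) (sa : S × A) :
    robustOp r γ D π Q sa ≤ robustOp r γ C π Q' sa + γ * c := by
  have hs := mul_le_mul_of_nonneg_left
    (suppFn_le_suppFn_add (hne sa.1 sa.2) (hCD sa.1 sa.2) (hD sa.1 sa.2) fun s =>
      sum_mul_le_of_mem_simplex (hπ s) fun a => h (s, a)) hγ0
  unfold robustOp
  linarith

/-- If every uniform bound `f ≤ g + c` improves to `f ≤ g + γ * c` with `γ < 1`,
then `f ≤ g`. -/
theorem le_of_forall_le_add_contract {ι : Type*} [Finite ι] {f g : ι → ℝ}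
    {γ : ℝ} (hγ1 : γ < 1)
    (h : ∀ c, (∀ i, f i ≤ g i + c) → ∀ i, f i ≤ g i + γ * c) (i : ι) : f i ≤ g i := by
  have : Nonempty ι := ⟨i⟩
  obtain ⟨j, hj⟩ := Finite.exists_max fun i => f i - g i
  have hi := hj i
  have hc := h (f j - g j) (fun i => by linarith [hj i]) j
  nlinarith

/-- **Robustness of the pessimistic proxies.**  With `𝒫̃_s^a = ∩_k (𝒫_k)_s^a`
(which contains the target kernel `P0`), the chain
`V_{P0}^π ≥ V_𝒫̃^π ≥ V_MP^π ≥ V_AO^π` holds for every policy and state. -/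
theorem pessimistic_proxy_robustness {S A : Type*} [Fintype S] [Fintype A]
    [Nonempty S] [Nonempty A]
    (r : S × A → ℝ) (hr : ∀ sa, 0 ≤ r sa ∧ r sa ≤ 1)
    (γ : ℝ) (hγ0 : 0 ≤ γ) (hγ1 : γ < 1)
    (K : ℕ) [NeZero K]
    (P : Fin K → S → A → Set (S → ℝ))
    (hP : ∀ k s a, (P k s a).Nonempty ∧ IsCompact (P k s a) ∧ P k s a ⊆ simplex S)
    (P0 : S → A → (S → ℝ)) (hP0 : ∀ k s a, P0 s a ∈ P k s a)
    (π : S → A → ℝ) (hπ : ∀ s, π s ∈ simplex A)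
    (QP0 : S × A → ℝ)
    (hQP0 : robustOp r γ (fun s a => {P0 s a}) π QP0 = QP0)
    (Qcap : S × A → ℝ)
    (hQcap : robustOp r γ (fun s a => ⋂ k, P k s a) π Qcap = Qcap)
    (QMP : S × A → ℝ)
    (hQMP : (fun sa => Finset.univ.sup' Finset.univ_nonempty
      (fun k => robustOp r γ (P k) π QMP sa)) = QMP)
    (QAO : S × A → ℝ)
    (hQAO : (fun sa => (K : ℝ)⁻¹ * ∑ k, robustOp r γ (P k) π QAO sa) = QAO) :
    ∀ s, (∑ a, π s a * QAO (s, a)) ≤ (∑ a, π s a * QMP (s, a))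
      ∧ (∑ a, π s a * QMP (s, a)) ≤ (∑ a, π s a * Qcap (s, a))
      ∧ (∑ a, π s a * Qcap (s, a)) ≤ (∑ a, π s a * QP0 (s, a)) := by
  have hcapne : ∀ s a, (⋂ k, P k s a).Nonempty := fun s a =>
    ⟨P0 s a, Set.mem_iInter.2 fun k => hP0 k s a⟩
  have hsimplex : ∀ k s a, P k s a ⊆ simplex S := fun k s a => (hP k s a).2.2
  have hAO : ∀ sa, QAO sa ≤ QMP sa := le_of_forall_le_add_contract hγ1 fun c hc sa => by
    have hk : ∀ k ∈ Finset.univ, robustOp r γ (P k) π QAO sa ≤ QMP sa + γ * c := fun k _ => by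
      have hle : robustOp r γ (P k) π QMP sa ≤ QMP sa :=
        (Finset.le_sup' (fun k => robustOp r γ (P k) π QMP sa) (Finset.mem_univ k)).trans_eq
          (congrFun hQMP sa)
      have hop := robustOp_le_robustOp_add r hγ0 (fun s a => (hP k s a).1)
        (fun s a => subset_rfl) (hsimplex k) hπ hc sa
      linarith
    have hsum := Finset.sum_le_card_nsmul _ _ _ hk
    rw [Finset.card_univ, Fintype.card_fin, nsmul_eq_mul] at hsum
    have hK : (0 : ℝ) < K := Nat.cast_pos.2 (NeZero.pos K)
    rw [← congrFun hQAO sa]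
    exact (inv_mul_le_iff₀ hK).2 hsum
  have hMP : ∀ sa, QMP sa ≤ Qcap sa := le_of_forall_le_add_contract hγ1 fun c hc sa => by
    rw [← congrFun hQMP sa, ← congrFun hQcap sa]
    exact Finset.sup'_le _ _ fun k _ => robustOp_le_robustOp_add r hγ0 hcapne
      (fun s a => Set.iInter_subset _ k) (hsimplex k) hπ hc sa
  have hcap : ∀ sa, Qcap sa ≤ QP0 sa := le_of_forall_le_add_contract hγ1 fun c hc sa => by
    rw [← congrFun hQcap sa, ← congrFun hQP0 sa]
    exact robustOp_le_robustOp_add r hγ0 (fun s a => Set.singleton_nonempty _)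
      (fun s a => Set.singleton_subset_iff.2 (Set.mem_iInter.2 fun k => hP0 k s a))
      (fun s a => (Set.iInter_subset _ 0).trans (hsimplex 0 s a)) hπ hc sa
  have hmono : ∀ {Q Q' : S × A → ℝ}, (∀ sa, Q sa ≤ Q' sa) →
      ∀ s, ∑ a, π s a * Q (s, a) ≤ ∑ a, π s a * Q' (s, a) := fun h s =>
    Finset.sum_le_sum fun a _ => mul_le_mul_of_nonneg_left (h (s, a)) ((hπ s).1 a)
  exact fun s => ⟨hmono hAO s, hmono hMP s, hmono hcap s⟩
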